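/- Suppose z : c₀ → {-1, 0, 1} satisfies the rationality axioms, with acceptance set Z. Then the topological interiors of Z and of -Z are disjoint: interior(Z) ∩ interior(-Z) = ∅. -/

import Mathlib

open scoped ZeroAtInfty

/-- There is a strictly positive sequence converging to zero. -/
theorem exists_zeroAtInfty_nat_pos : ∃ p : C₀(ℕ, ℝ), ∀ k, 0 < p k := by
  refine ⟨⟨⟨fun k => 1 / ((k : ℝ) + 1), continuous_of_discreteTopology⟩, ?_⟩, fun k => ?_⟩
  · rw [Filter.cocompact_eq_cofinite, Nat.cofinite_eq_atTop]
    exact tendsto_one_div_add_atTop_nhds_zero_nat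
  · exact Nat.one_div_pos_of_nat

/-- From an interior point one can move a positive distance in the direction `-p`
without leaving the set. -/
theorem exists_pos_sub_smul_mem_of_mem_interior {E : Type*} [AddCommGroup E] [Module ℝ E]
    [TopologicalSpace E] [IsTopologicalAddGroup E] [ContinuousSMul ℝ E]
    {s : Set E} {r : E} (hr : r ∈ interior s) (p : E) :
    ∃ t : ℝ, 0 < t ∧ r - t • p ∈ s := by
  have hcont : Continuous fun t : ℝ => r - t • p := by fun_prop
  have hnhds : ∀ᶠ t in nhds (0 : ℝ), r - t • p ∈ s :=
    hcont.continuousAt.eventually_mem (by simpa using mem_interior_iff_mem_nhds.mp hr)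
  obtain ⟨t, hts, ht⟩ :=
    ((hnhds.filter_mono nhdsWithin_le_nhds).and (self_mem_nhdsWithin (s := Set.Ioi 0))).exists
  exact ⟨t, ht, hts⟩

/-- For a rational decision function `z` on `c₀` with acceptance set `Z`,
the interiors of `Z` and `-Z` are disjoint. -/
theorem rational_acceptance_interiors_disjoint
    (z : C₀(ℕ, ℝ) → ℤ) (hz : ∀ r, z r ∈ ({-1, 0, 1} : Set ℤ))
    (Z : Set C₀(ℕ, ℝ)) (hZ : Z = {r | z r = 0 ∨ z r = 1})
    (ax1 : ∀ r : C₀(ℕ, ℝ), (z r = 0 ∨ z r = 1) ↔ (z (-r) = -1 ∨ z (-r) = 0))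
    (ax2 : ∀ r ∈ Z, ∀ s ∈ Z, ∀ l g : ℝ, 0 ≤ l → 0 ≤ g → l • r + g • s ∈ Z)
    (ax3a : ∀ r : C₀(ℕ, ℝ), (∀ k, 0 ≤ r k) → r ∈ Z)
    (ax3b : ∀ r : C₀(ℕ, ℝ), (∀ k, 0 < r k) → z r = 1) :
    interior Z ∩ interior (-Z) = ∅ := by
  obtain ⟨p, hp⟩ := exists_zeroAtInfty_nat_pos
  refine Set.eq_empty_of_forall_notMem fun r ⟨hr, hr'⟩ => ?_
  have hneg : -r ∈ Z := Set.mem_neg.mp (interior_subset hr')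
  obtain ⟨t, ht, hmem⟩ := exists_pos_sub_smul_mem_of_mem_interior hr p
  have hsum : -(t • p) ∈ Z := by
    have h := ax2 _ hmem _ hneg 1 1 zero_le_one zero_le_one
    rwa [one_smul, one_smul, sub_add_eq_add_sub, add_neg_cancel, zero_sub] at h
  have hone : z (t • p) = 1 := ax3b _ fun k => mul_pos ht (hp k)
  rw [hZ] at hsum
  have h := (ax1 _).mp hsum
  rw [neg_neg, hone] at h
  omega
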